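/- arXiv:2305.14521 — 2 statements merged into one kernel-verified Lean document; each statement's English description precedes it below -/
import Mathlib

section
/- Let m ≥ 1 and reals p, s, σ₁, σ_ξ, r with σ_ξ² = r·m. Let Y' ∈ {−1,1}^m, let v = (1, 2p−1) ∈ ℝ², and let N = (σ_ξ/m)·v·Y'ᵀ ∈ ℝ^{2×m}. Let F' ∈ ℝ^{2×m} satisfy (1/m)·F'·F'ᵀ = G_core and (1/m)·F'·Y' = (1, 0), where G_core = [[1+σ₁², 0],[0, 1]]. Define B = s(1−s)·N + s²·(σ_ξ/m)·F' ∈ ℝ^{2×m}. Then B·Bᵀ = s²(1−s)²·r·J + s⁴·r·G_core + s³(1−s)·r·H, where J = [[1, 2p−1],[2p−1, (2p−1)²]] and H = [[2, 2p−1],[2p−1, 0]]. -/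
open Matrix

/-- Computation of `B Bᵀ` in Appendix A.1 of the paper, where
`B = s(1-s) N + s² (σ_ξ/m) F'` is the off-diagonal block of the regularized Gram
matrix of the mixed dataset. -/
theorem stmt_5
    (m : ℕ) (hm : 1 ≤ m)
    (p s σ₁ σξ r : ℝ) (hr : σξ^2 = r * m)
    (Y' : Fin m → ℝ) (hY' : ∀ j, Y' j = 1 ∨ Y' j = -1)
    (N : Matrix (Fin 2) (Fin m) ℝ)
    (hN : N = Matrix.of fun a j => (σξ/m) * (![1, 2*p-1] a) * Y' j)
    (F' : Matrix (Fin 2) (Fin m) ℝ)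
    (hFF : (1/(m:ℝ)) • (F' * F'ᵀ) = !![1+σ₁^2, 0; 0, 1])
    (hFY : (1/(m:ℝ)) • (F' *ᵥ Y') = ![1, 0])
    (B : Matrix (Fin 2) (Fin m) ℝ)
    (hB : B = (s*(1-s)) • N + (s^2 * (σξ/m)) • F') :
    B * Bᵀ = (s^2*(1-s)^2*r) • !![1, 2*p-1; 2*p-1, (2*p-1)^2]
      + (s^4*r) • !![1+σ₁^2, 0; 0, 1]
      + (s^3*(1-s)*r) • !![2, 2*p-1; 2*p-1, 0] := by
  have hm0 : (m : ℝ) ≠ 0 := by positivity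
  have hYY : ∑ j, Y' j * Y' j = m := by
    have h1 : ∀ j, Y' j * Y' j = 1 := fun j => by rcases hY' j with h | h <;> simp [h]
    simp [h1]
  have hFY_sum : ∀ a, ∑ j, F' a j * Y' j = m * (![1, 0] : Fin 2 → ℝ) a := fun a => by
    rw [← hFY]
    simp [mulVec, dotProduct, hm0]
  have hFF_sum : ∀ a b, ∑ j, F' a j * F' b j
      = m * (!![1+σ₁^2, 0; 0, 1] : Matrix (Fin 2) (Fin 2) ℝ) a b := fun a b => by
    rw [← hFF]
    simp [mul_apply, hm0]
  have hr' : r = σξ^2 / m := by rw [hr]; field_simp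
  have entry : ∀ a b, (B * Bᵀ) a b = (σξ/m)^2 *
      ((s*(1-s))^2 * (![1, 2*p-1] a * ![1, 2*p-1] b) * ∑ j, Y' j * Y' j
        + s^3*(1-s) * (![1, 2*p-1] a * ∑ j, F' b j * Y' j)
        + s^3*(1-s) * (![1, 2*p-1] b * ∑ j, F' a j * Y' j)
        + s^4 * ∑ j, F' a j * F' b j) := fun a b => by
    simp only [mul_apply, transpose_apply, hB, hN, Matrix.add_apply, Matrix.smul_apply,
      of_apply, smul_eq_mul, Finset.mul_sum, ← Finset.sum_add_distrib]
    exact Finset.sum_congr rfl fun j _ => by ring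
  ext a b
  rw [entry, hYY, hFY_sum, hFY_sum, hFF_sum, hr']
  fin_cases a <;> fin_cases b <;> simp <;> field_simp <;> ring
end

section
/- Let d ≥ 2, n ≥ 1, s ∈ ℝ, λ > 0. Let x̃₁,…,x̃_n ∈ ℝ^d satisfy (x̃_i)₂ = s for every i (the second coordinate of every input equals the constant s), and let y₁,…,y_n ∈ ℝ. Define L(w, b) = (1/n)·Σ_{i=1}^n (⟨w, x̃_i⟩ + b − y_i)² + λ·‖w‖² for (w, b) ∈ ℝ^d × ℝ. Then a global minimizer of L exists, and every global minimizer (w*, b*) satisfies ⟨w*, e₂⟩ = 0, where e₂ is the second standard basis vector of ℝ^d. -/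
/-- The ridge-regularized mean squared error of an affine model, with unpenalized bias, has a
global minimizer. -/
theorem exists_forall_ridge_loss_le {ι κ : Type*} [Fintype ι] [Nonempty ι] [Fintype κ]
    {c lam : ℝ} (hc : 0 < c) (hlam : 0 < lam) (x : ι → κ → ℝ) (y : ι → ℝ) :
    ∃ wb : (κ → ℝ) × ℝ, ∀ wb' : (κ → ℝ) × ℝ,
      c * ∑ i, ((∑ j, wb.1 j * x i j) + wb.2 - y i) ^ 2 + lam * ∑ j, (wb.1 j) ^ 2 ≤
      c * ∑ i, ((∑ j, wb'.1 j * x i j) + wb'.2 - y i) ^ 2 + lam * ∑ j, (wb'.1 j) ^ 2 := by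
  set L : (κ → ℝ) × ℝ → ℝ := fun wb =>
    c * ∑ i, ((∑ j, wb.1 j * x i j) + wb.2 - y i) ^ 2 + lam * ∑ j, (wb.1 j) ^ 2 with hL
  have hcont : Continuous L := by
    rw [hL]
    fun_prop
  obtain ⟨i₀⟩ := ‹Nonempty ι›
  set C := L 0
  set M := C / lam + 1
  set B := C / c + 1 + |y i₀| + ∑ j, M * |x i₀ j|
  have hcpt : IsCompact (Set.Icc (fun _ : κ => -M) (fun _ => M) ×ˢ Set.Icc (-B) B) :=
    isCompact_Icc.prod isCompact_Icc
  refine hcont.exists_forall_le' 0 ?_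
  filter_upwards [hcpt.compl_mem_cocompact] with wb hwb
  by_contra! hlt
  refine hwb ?_
  have hS : 0 ≤ ∑ i, ((∑ j, wb.1 j * x i j) + wb.2 - y i) ^ 2 := by positivity
  have hT : 0 ≤ ∑ j, (wb.1 j) ^ 2 := by positivity
  have hlt' : c * ∑ i, ((∑ j, wb.1 j * x i j) + wb.2 - y i) ^ 2 + lam * ∑ j, (wb.1 j) ^ 2 < C :=
    hlt
  have abs_le_of_sq_le {a t : ℝ} (h : a ^ 2 ≤ t) : |a| ≤ t + 1 := by
    nlinarith [sq_abs a, sq_nonneg (|a| - 1)]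
  have hw (j : κ) : |wb.1 j| ≤ M := by
    refine abs_le_of_sq_le ?_
    have hj : (wb.1 j) ^ 2 ≤ ∑ j, (wb.1 j) ^ 2 :=
      Finset.single_le_sum (f := fun j => (wb.1 j) ^ 2) (fun _ _ => sq_nonneg _)
        (Finset.mem_univ j)
    rw [le_div_iff₀ hlam]
    nlinarith
  have hr : |(∑ j, wb.1 j * x i₀ j) + wb.2 - y i₀| ≤ C / c + 1 := by
    refine abs_le_of_sq_le ?_
    have hi : ((∑ j, wb.1 j * x i₀ j) + wb.2 - y i₀) ^ 2 ≤
        ∑ i, ((∑ j, wb.1 j * x i j) + wb.2 - y i) ^ 2 :=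
      Finset.single_le_sum (f := fun i => ((∑ j, wb.1 j * x i j) + wb.2 - y i) ^ 2)
        (fun _ _ => sq_nonneg _) (Finset.mem_univ i₀)
    rw [le_div_iff₀ hc]
    nlinarith
  have hin : |∑ j, wb.1 j * x i₀ j| ≤ ∑ j, M * |x i₀ j| := by
    refine (Finset.abs_sum_le_sum_abs _ _).trans (Finset.sum_le_sum fun j _ => ?_)
    rw [abs_mul]
    exact mul_le_mul_of_nonneg_right (hw j) (abs_nonneg _)
  have hb : |wb.2| ≤ B := by
    rw [abs_le] at hr hin ⊢
    constructor <;> linarith [le_abs_self (y i₀), neg_abs_le (y i₀)]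
  exact ⟨⟨fun j => (abs_le.1 (hw j)).1, fun j => (abs_le.1 (hw j)).2⟩, abs_le.1 hb⟩

/-- Theorem 2 of the paper: on the mixed dataset, where every input's second
(spurious) coordinate equals the constant `s`, the ℓ₂-regularized MSE loss of a
linear model with (unpenalized) bias has a global minimizer, and every global
minimizer has zero weight on the spurious direction `e₂`. -/
theorem stmt_14
    (d n : ℕ) (hd : 2 ≤ d) (hn : 1 ≤ n) (s lam : ℝ) (hlam : 0 < lam)
    (xt : Fin n → Fin d → ℝ) (hxt : ∀ i, xt i ⟨1, hd⟩ = s)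
    (y : Fin n → ℝ)
    (L : (Fin d → ℝ) × ℝ → ℝ)
    (hL : L = fun wb => (1/(n:ℝ)) * ∑ i, ((∑ j, wb.1 j * xt i j) + wb.2 - y i)^2
      + lam * ∑ j, (wb.1 j)^2) :
    (∃ wb, ∀ wb', L wb ≤ L wb') ∧
    (∀ wb, (∀ wb', L wb ≤ L wb') → wb.1 ⟨1, hd⟩ = 0) := by
  subst hL
  have : Nonempty (Fin n) := ⟨⟨0, hn⟩⟩
  refine ⟨exists_forall_ridge_loss_le (by positivity) hlam xt y, fun wb hmin => ?_⟩
  set k : Fin d := ⟨1, hd⟩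
  have h := hmin (Function.update wb.1 k 0, wb.2 + s * wb.1 k)
  have hsum (i : Fin n) : (∑ j, Function.update wb.1 k 0 j * xt i j) + (wb.2 + s * wb.1 k) =
      (∑ j, wb.1 j * xt i j) + wb.2 := by
    rw [Fintype.sum_eq_add_sum_compl k, Fintype.sum_eq_add_sum_compl k (fun j => wb.1 j * xt i j),
      Finset.sum_congr rfl fun j hj => by
        rw [Function.update_of_ne (by simpa using hj)], Function.update_self, hxt i]
    ring
  have hsq : ∑ j, (wb.1 j) ^ 2 = (wb.1 k) ^ 2 + ∑ j, (Function.update wb.1 k 0 j) ^ 2 := by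
    rw [Fintype.sum_eq_add_sum_compl k,
      Fintype.sum_eq_add_sum_compl k (fun j => (Function.update wb.1 k 0 j) ^ 2),
      Function.update_self]
    rw [Finset.sum_congr rfl fun j hj => by
      rw [← Function.update_of_ne (f := wb.1) (a' := k) (by simpa using hj) 0]]
    ring
  simp only [hsum] at h
  rw [hsq] at h
  have hk : (wb.1 k) ^ 2 ≤ 0 := by nlinarith
  exact pow_eq_zero_iff two_ne_zero |>.1 (le_antisymm hk (sq_nonneg _))
end
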